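/- Let ℒ : ℝ^p → ℝ be differentiable with L-Lipschitz gradient, bounded below with infimum ℒ* = ℒ(W*), and satisfying the Polyak–Łojasiewicz condition with constant μ > 0: ‖∇ℒ(W)‖² ≥ 2μ (ℒ(W) − ℒ*) for all W. Let D ∈ ℝ^{p×p} be diagonal with α I ≼ D ≼ Γ I for some 0 < α ≤ Γ, let γ > 0, m ∈ ℝ^p, and W' = W − γ D^{−1} m. Then ℒ(W') − ℒ* ≤ (1 − γμ/Γ) (ℒ(W) − ℒ*) + (γ/(2α)) ‖∇ℒ(W) − m‖² − (1/(2γ) − L/(2α)) ‖W' − W‖²_D, where ‖v‖²_D = ⟨v, D v⟩. -/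

import Mathlib

/-- The quadratic upper bound for a function whose gradient is `L`-Lipschitz. -/
theorem le_add_inner_gradient_add_of_gradient_lipschitz {F : Type*} [NormedAddCommGroup F]
    [InnerProductSpace ℝ F] [CompleteSpace F] {f : F → ℝ} {L : ℝ} (hf : Differentiable ℝ f)
    (hL : ∀ x y, ‖gradient f x - gradient f y‖ ≤ L * ‖x - y‖) (x v : F) :
    f (x + v) ≤ f x + inner ℝ (gradient f x) v + L / 2 * ‖v‖ ^ 2 := by
  have hφ (t : ℝ) : HasDerivAt (fun s : ℝ => f (x + s • v))
      (inner ℝ (gradient f (x + t • v)) v) t := by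
    have hline : HasDerivAt (fun s : ℝ => x + s • v) v t := by
      simpa using ((hasDerivAt_id t).smul_const v).const_add x
    have h := (hf (x + t • v)).hasGradientAt.hasFDerivAt.comp_hasDerivAt t hline
    simpa [Function.comp_def] using h
  have hB (t : ℝ) : HasDerivAt
      (fun s : ℝ => f x + s * inner ℝ (gradient f x) v + L / 2 * ‖v‖ ^ 2 * s ^ 2)
      (inner ℝ (gradient f x) v + L * t * ‖v‖ ^ 2) t := by
    have h := (((hasDerivAt_id t).mul_const (inner ℝ (gradient f x) v)).const_add (f x)).add
      ((hasDerivAt_pow 2 t).const_mul (L / 2 * ‖v‖ ^ 2))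
    refine h.congr_deriv ?_
    norm_num
    ring
  have hbound : ∀ t ∈ Set.Ico (0 : ℝ) 1, inner ℝ (gradient f (x + t • v)) v ≤
      inner ℝ (gradient f x) v + L * t * ‖v‖ ^ 2 := by
    intro t ht
    have hcs := real_inner_le_norm (gradient f (x + t • v) - gradient f x) v
    have hlip := hL (x + t • v) x
    rw [add_sub_cancel_left, norm_smul, Real.norm_of_nonneg ht.1] at hlip
    rw [inner_sub_left] at hcs
    nlinarith [mul_le_mul_of_nonneg_right hlip (norm_nonneg v)]
  have key := image_le_of_deriv_right_le_deriv_boundary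
    (fun t _ => (hφ t).continuousAt.continuousWithinAt)
    (fun t _ => (hφ t).hasDerivWithinAt) (by simp)
    (fun t _ => (hB t).continuousAt.continuousWithinAt)
    (fun t _ => (hB t).hasDerivWithinAt) hbound (Set.right_mem_Icc.2 zero_le_one)
  simpa using key

/-- A gradient-step cross term for one coordinate, after completing the square. -/
theorem mul_step_le {α Γ γ d g m v : ℝ} (hα : 0 < α) (hγ : 0 < γ) (hd : α ≤ d) (hdΓ : d ≤ Γ)
    (hv : v = -(γ * (m / d))) :
    g * v ≤ γ / (2 * α) * (g - m) ^ 2 - γ / (2 * Γ) * g ^ 2 - 1 / (2 * γ) * (d * v ^ 2) := by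
  have hd0 : 0 < d := hα.trans_le hd
  have hsq : g * v =
      γ / (2 * d) * (g - m) ^ 2 - γ / (2 * d) * g ^ 2 - 1 / (2 * γ) * (d * v ^ 2) := by
    subst hv
    field_simp
    ring
  have h1 : γ / (2 * d) * (g - m) ^ 2 ≤ γ / (2 * α) * (g - m) ^ 2 := by gcongr
  have h2 : γ / (2 * Γ) * g ^ 2 ≤ γ / (2 * d) * g ^ 2 := by gcongr
  linarith


/-- Per-step convergence lemma for a preconditioned (Adam-type) update
under `L`-smoothness, the Polyak–Łojasiewicz condition with constant `μ > 0`
(`‖∇ℒ(W)‖² ≥ 2μ(ℒ(W) − ℒ*)` with `ℒ* = ℒ(W*)` the infimum), and two-sided diagonal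
preconditioner bounds `α I ≼ D ≼ Γ I` (`0 < α ≤ Γ`): with `W' = W − γ D⁻¹ m`,
`ℒ(W') − ℒ* ≤ (1 − γμ/Γ)(ℒ(W) − ℒ*) + (γ/(2α))‖∇ℒ(W) − m‖² − (1/(2γ) − L/(2α))‖W' − W‖²_D`,
where `‖v‖²_D = Σᵢ dᵢ vᵢ²`. -/
theorem pl_descent_lemma_preconditioned
    (p : ℕ) (L α Γ γ μ : ℝ)
    (hα : 0 < α) (hαΓ : α ≤ Γ) (hγ : 0 < γ) (hμ : 0 < μ)
    (ℒ : EuclideanSpace ℝ (Fin p) → ℝ)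
    (hdiff : Differentiable ℝ ℒ)
    (hLip : ∀ x y : EuclideanSpace ℝ (Fin p),
      ‖gradient ℒ x - gradient ℒ y‖ ≤ L * ‖x - y‖)
    (Wstar : EuclideanSpace ℝ (Fin p)) (Lstar : ℝ)
    (hLstar : Lstar = ℒ Wstar)
    (hlb : ∀ W, Lstar ≤ ℒ W)
    (hPL : ∀ W : EuclideanSpace ℝ (Fin p), ‖gradient ℒ W‖ ^ 2 ≥ 2 * μ * (ℒ W - Lstar))
    (d : Fin p → ℝ) (hd : ∀ i, α ≤ d i) (hdΓ : ∀ i, d i ≤ Γ)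
    (m W W' : EuclideanSpace ℝ (Fin p))
    (hW' : ∀ i, W' i = W i - γ * (m i / d i)) :
    ℒ W' - Lstar ≤ (1 - γ * μ / Γ) * (ℒ W - Lstar)
      + (γ / (2 * α)) * ‖gradient ℒ W - m‖ ^ 2
      - (1 / (2 * γ) - L / (2 * α)) * (∑ i, d i * (W' i - W i) ^ 2) := by
  have hstep (i : Fin p) : (W' - W) i = -(γ * (m i / d i)) := by
    rw [PiLp.sub_apply, hW' i]
    ring
  have hdesc := le_add_inner_gradient_add_of_gradient_lipschitz hdiff hLip W (W' - W)
  rw [add_sub_cancel] at hdesc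
  have hcross : inner ℝ (gradient ℒ W) (W' - W) ≤ γ / (2 * α) * ‖gradient ℒ W - m‖ ^ 2
      - γ / (2 * Γ) * ‖gradient ℒ W‖ ^ 2 - 1 / (2 * γ) * ∑ i, d i * (W' i - W i) ^ 2 := by
    simp only [EuclideanSpace.real_norm_sq_eq, PiLp.inner_apply, Finset.mul_sum,
      ← Finset.sum_sub_distrib]
    refine Finset.sum_le_sum fun i _ => ?_
    have h := mul_step_le (g := gradient ℒ W i) hα hγ (hd i) (hdΓ i) (hstep i)
    simpa [mul_comm] using h
  have hnorm : α * ‖W' - W‖ ^ 2 ≤ ∑ i, d i * (W' i - W i) ^ 2 := by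
    rw [EuclideanSpace.real_norm_sq_eq, Finset.mul_sum]
    exact Finset.sum_le_sum fun i _ => mul_le_mul_of_nonneg_right (hd i) (sq_nonneg _)
  have hquad : L / 2 * ‖W' - W‖ ^ 2 ≤ L / (2 * α) * ∑ i, d i * (W' i - W i) ^ 2 := by
    rcases le_or_gt 0 L with hL | hL
    · calc L / 2 * ‖W' - W‖ ^ 2 = L / (2 * α) * (α * ‖W' - W‖ ^ 2) := by field_simp
        _ ≤ _ := by gcongr
    · have h0 : ‖W' - W‖ = 0 := by
        nlinarith [(norm_nonneg _).trans (hLip W' W), norm_nonneg (W' - W)]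
      have hWW : W' = W := sub_eq_zero.1 (norm_eq_zero.1 h0)
      simp [hWW]
  have hΓ : 0 < Γ := hα.trans_le hαΓ
  have hpl : γ * μ / Γ * (ℒ W - Lstar) ≤ γ / (2 * Γ) * ‖gradient ℒ W‖ ^ 2 := by
    calc γ * μ / Γ * (ℒ W - Lstar) = γ / (2 * Γ) * (2 * μ * (ℒ W - Lstar)) := by field_simp
      _ ≤ _ := by
        gcongr
        exact hPL W
  linarith
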